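/- arXiv:2205.08415 — 2 statements merged into one kernel-verified Lean document; each statement's English description precedes it below -/
import Mathlib

section
/- Assume A satisfies condition (103) and f satisfies condition (109). Let a > 0, 0 < R ≤ ∞, and let φ be a positive solution of the Cauchy problem (204) on [0,R). Then lim_{r→0⁺} A(φ′(r))φ′(r)/r = (f(a)^k / C(n,k))^{1/k}; in particular the function h(r) = ∫₀^r A(|φ′(s)|)φ′(s) ds belongs to C²[0,R) with h′(0) = 0 and h″(0) = (f(a)^k / C(n,k))^{1/k}. -/
open Filter MeasureTheory Set Topology
open scoped ENNReal

noncomputable section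

abbrev Euc (n : ℕ) := EuclideanSpace ℝ (Fin n)

/-- k-th elementary symmetric function of λ ∈ ℝⁿ. -/
def sigmaElem (n k : ℕ) (lam : Fin n → ℝ) : ℝ :=
  ∑ S ∈ Finset.powersetCard k (Finset.univ : Finset (Fin n)), ∏ i ∈ S, lam i

/-- The cone Γ_k. -/
def GammaK (n k : ℕ) : Set (Fin n → ℝ) :=
  {lam | ∀ l, 1 ≤ l → l ≤ k → 0 < sigmaElem n l lam}

/-- Matrix (D_i V_j) of a vector field V. -/
def jacMatrix {n : ℕ} (V : Euc n → Euc n) (x : Euc n) : Matrix (Fin n) (Fin n) ℝ :=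
  fun i j => fderiv ℝ (fun y => V y j) x (EuclideanSpace.single i 1)

/-- Condition (103). -/
def Cond103 (A : ℝ → ℝ) : Prop :=
  ContDiffOn ℝ 1 A (Ioi 0) ∧ (∀ p ∈ Ioi (0:ℝ), 0 < A p) ∧
  ContinuousOn (fun p => p * A p) (Ici 0) ∧
  StrictMonoOn (fun p => p * A p) (Ioi 0)

/-- Condition (109). -/
def Cond109 (f : ℝ → ℝ) : Prop :=
  ContinuousOn f (Ioi 0) ∧ (∀ t ∈ Ioi (0:ℝ), 0 < f t) ∧ MonotoneOn f (Ioi 0)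

/-- Condition (117). -/
def Cond117 (f : ℝ → ℝ) : Prop :=
  Continuous f ∧ (∀ t, 0 < f t) ∧ Monotone f

/-- Condition (108): 0 < liminf A(p)/p^{m-2} ≤ limsup A(p)/p^{m-2} < ∞. -/
def Cond108 (A : ℝ → ℝ) (m : ℝ) : Prop :=
  ∃ c₁ c₂ : ℝ, 0 < c₁ ∧
    ∀ᶠ p in atTop, c₁ ≤ A p / p ^ (m - 2) ∧ A p / p ^ (m - 2) ≤ c₂

/-- u ∈ C²(ℝⁿ \ {0}) ∩ Φᵏ(ℝⁿ) is an entire solution of inequality (101). -/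
def IsEntireSol (n k : ℕ) (A f : ℝ → ℝ) (u : Euc n → ℝ) : Prop :=
  ContDiff ℝ 1 u ∧ ContDiffOn ℝ 2 u {(0 : Euc n)}ᶜ ∧
  ∃ V : Euc n → Euc n, ContDiff ℝ 1 V ∧
    (∀ x, V x = A ‖gradient u x‖ • gradient u x) ∧
    ∃ hsym : ∀ x, (jacMatrix V x).IsHermitian,
      (∀ x, (hsym x).eigenvalues ∈ GammaK n k) ∧
      ∀ x, f (u x) ≤ (sigmaElem n k ((hsym x).eigenvalues)) ^ ((1:ℝ)/k)

/-- Ψ(p) = p (pA(p))^k − ∫₀^p (tA(t))^k dt. -/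
def Psi (A : ℝ → ℝ) (k : ℕ) (p : ℝ) : ℝ :=
  p * (p * A p) ^ k - ∫ t in (0:ℝ)..p, (t * A t) ^ k

/-- Ψ⁻¹, the inverse of Ψ on [0,∞). -/
def PsiInv (A : ℝ → ℝ) (k : ℕ) : ℝ → ℝ :=
  Function.invFunOn (Psi A k) (Ici 0)

/-- Generalized Keller–Osserman condition (110) with lower limit c. -/
def KO (A f : ℝ → ℝ) (k : ℕ) (c : ℝ) : Prop :=
  ∫⁻ s in Ioi c, ENNReal.ofReal (PsiInv A k (∫ t in c..s, f t ^ k))⁻¹ = ⊤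

/-- [0,R) with R ∈ [0,∞]. -/
def IcoE (R : ℝ≥0∞) : Set ℝ := {r : ℝ | 0 ≤ r ∧ ENNReal.ofReal r < R}

/-- (0,R) with R ∈ [0,∞]. -/
def IooE (R : ℝ≥0∞) : Set ℝ := {r : ℝ | 0 < r ∧ ENNReal.ofReal r < R}

/-- φ is a positive solution of the Cauchy problem (204) on [0,R). -/
def IsCauchySol (n k : ℕ) (A f : ℝ → ℝ) (a : ℝ) (R : ℝ≥0∞) (φ : ℝ → ℝ) : Prop :=
  ContinuousOn φ (IcoE R) ∧
  (∀ r ∈ IooE R, DifferentiableAt ℝ φ r) ∧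
  ContinuousOn (deriv φ) (IooE R) ∧
  φ 0 = a ∧
  (∀ r ∈ IcoE R, 0 < φ r) ∧
  ∀ r ∈ IooE R,
    A |deriv φ r| * deriv φ r =
      (n * r ^ ((k:ℝ) - n) / (n.choose k) * ∫ s in (0:ℝ)..r, s ^ (n-1) * f (φ s) ^ k) ^ ((1:ℝ)/k)


lemma exists_gt_Icc_subset_IcoE {R : ℝ≥0∞} {r : ℝ} (hr : r ∈ IcoE R) :
    ∃ b, r < b ∧ Icc 0 b ⊆ IcoE R := by
  have hopen : IsOpen {x : ℝ | ENNReal.ofReal x < R} :=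
    isOpen_lt ENNReal.continuous_ofReal continuous_const
  obtain ⟨b, hb, hsub⟩ := exists_Ico_subset_of_mem_nhds (hopen.mem_nhds hr.2) (exists_gt r)
  refine ⟨(r + b) / 2, by linarith, fun x hx => ⟨hx.1, ?_⟩⟩
  have hmid : (r + b) / 2 ∈ Ico r b := ⟨by linarith, by linarith⟩
  exact (ENNReal.ofReal_le_ofReal hx.2).trans_lt (hsub hmid)

lemma IcoE_mem_nhds {R : ℝ≥0∞} {r : ℝ} (hr : r ∈ IooE R) : IcoE R ∈ 𝓝 r := by
  obtain ⟨b, hb, hsub⟩ := exists_gt_Icc_subset_IcoE (R := R) (r := r) ⟨hr.1.le, hr.2⟩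
  exact mem_of_superset (Icc_mem_nhds hr.1 hb) hsub

lemma Icc_subset_IcoE {R : ℝ≥0∞} {r : ℝ} (hr : r ∈ IcoE R) : Icc 0 r ⊆ IcoE R :=
  fun _ hx => ⟨hx.1, (ENNReal.ofReal_le_ofReal hx.2).trans_lt hr.2⟩

/-- The fundamental theorem of calculus on `[0, R)`, including the endpoint `0`. -/
lemma hasDerivWithinAt_integral_IcoE {R : ℝ≥0∞} {F : ℝ → ℝ} (hF : ContinuousOn F (IcoE R))
    {r : ℝ} (hr : r ∈ IcoE R) :
    HasDerivWithinAt (fun ρ => ∫ s in (0:ℝ)..ρ, F s) (F r) (IcoE R) r := by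
  obtain ⟨b, hb, hsub⟩ := exists_gt_Icc_subset_IcoE hr
  have h0b : (0:ℝ) ≤ b := hr.1.trans hb.le
  set E : ℝ → ℝ := IccExtend h0b ((Icc 0 b).domRestrict F) with hE
  have hEc : Continuous E := (hF.mono hsub).domRestrict.Icc_extend'
  have hEF : ∀ x ∈ Icc 0 b, E x = F x := fun x hx => by
    rw [hE, IccExtend_of_mem _ _ hx, domRestrict_apply]
  have heq : ∀ ρ ∈ Icc 0 b, (∫ s in (0:ℝ)..ρ, F s) = ∫ s in (0:ℝ)..ρ, E s := fun ρ hρ =>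
    intervalIntegral.integral_congr fun x hx => by
      rw [uIcc_of_le hρ.1] at hx
      exact (hEF x ⟨hx.1, hx.2.trans hρ.2⟩).symm
  have hd := (hEc.integral_hasStrictDerivAt 0 r).hasDerivAt.hasDerivWithinAt (s := IcoE R)
  rw [hEF r ⟨hr.1, hb.le⟩] at hd
  refine hd.congr_of_eventuallyEq ?_ (heq r ⟨hr.1, hb.le⟩)
  filter_upwards [self_mem_nhdsWithin, mem_nhdsWithin_of_mem_nhds (Iio_mem_nhds hb)] with x hx hxb
  exact heq x ⟨hx.1, le_of_lt hxb⟩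

/-- The mean of the radial function `g` over the `n`-dimensional ball of radius `r`. -/
def radialMean (n : ℕ) (g : ℝ → ℝ) (r : ℝ) : ℝ :=
  if r = 0 then g 0 else n / r ^ n * ∫ s in (0:ℝ)..r, s ^ (n - 1) * g s

lemma radialMean_zero (n : ℕ) (g : ℝ → ℝ) : radialMean n g 0 = g 0 := if_pos rfl

lemma radialMean_of_ne {n : ℕ} {g : ℝ → ℝ} {r : ℝ} (hr : r ≠ 0) :
    radialMean n g r = n / r ^ n * ∫ s in (0:ℝ)..r, s ^ (n - 1) * g s := if_neg hr

lemma continuousOn_pow_mul {R : ℝ≥0∞} {g : ℝ → ℝ} (hg : ContinuousOn g (IcoE R)) (m : ℕ) :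
    ContinuousOn (fun s => s ^ m * g s) (IcoE R) :=
  (continuous_pow m).continuousOn.mul hg

lemma hasDerivAt_integral_pow_mul {R : ℝ≥0∞} {g : ℝ → ℝ} (hg : ContinuousOn g (IcoE R)) (m : ℕ)
    {r : ℝ} (hr : r ∈ IooE R) :
    HasDerivAt (fun ρ => ∫ s in (0:ℝ)..ρ, s ^ m * g s) (r ^ m * g r) r :=
  (hasDerivWithinAt_integral_IcoE (continuousOn_pow_mul hg m)
    ⟨hr.1.le, hr.2⟩).hasDerivAt (IcoE_mem_nhds hr)

lemma hasDerivAt_radialMean {R : ℝ≥0∞} {n : ℕ} (hn : 1 ≤ n) {g : ℝ → ℝ}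
    (hg : ContinuousOn g (IcoE R)) {r : ℝ} (hr : r ∈ IooE R) :
    HasDerivAt (radialMean n g) (n / r * (g r - radialMean n g r)) r := by
  have hr0 : r ≠ 0 := hr.1.ne'
  have hd := ((hasDerivAt_const r (n : ℝ)).div (hasDerivAt_pow n r) (pow_ne_zero n hr0)).mul
    (hasDerivAt_integral_pow_mul hg (n - 1) hr)
  refine (hd.congr_of_eventuallyEq ?_).congr_deriv ?_
  · filter_upwards [isOpen_ne.mem_nhds hr0] with x hx
    exact radialMean_of_ne hx
  · rw [radialMean_of_ne hr0]
    obtain ⟨m, rfl⟩ : ∃ m, n = m + 1 := ⟨n - 1, by omega⟩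
    simp only [Nat.add_sub_cancel, Pi.div_apply]
    field_simp
    ring

lemma tendsto_radialMean_zero {R : ℝ≥0∞} (hR : 0 < R) {n : ℕ} (hn : 1 ≤ n) {g : ℝ → ℝ}
    (hg : ContinuousOn g (IcoE R)) :
    Tendsto (radialMean n g) (𝓝[>] 0) (𝓝 (g 0)) := by
  have h0 : (0:ℝ) ∈ IcoE R := ⟨le_rfl, by simpa using hR⟩
  obtain ⟨b, hb, hsub⟩ := exists_gt_Icc_subset_IcoE h0
  have hev : ∀ᶠ x in 𝓝[>] (0:ℝ), x ∈ IooE R := by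
    filter_upwards [Ioo_mem_nhdsGT hb] with x hx
    exact ⟨hx.1, (hsub ⟨hx.1.le, hx.2.le⟩).2⟩
  have hle : 𝓝[>] (0:ℝ) ≤ 𝓝[IcoE R] 0 :=
    le_inf nhdsWithin_le_nhds (le_principal_iff.2 (hev.mono fun x hx => ⟨hx.1.le, hx.2⟩))
  have hnum : Tendsto (fun ρ => ∫ s in (0:ℝ)..ρ, s ^ (n - 1) * g s) (𝓝[>] 0) (𝓝 0) := by
    have := (hasDerivWithinAt_integral_IcoE
      (continuousOn_pow_mul hg (n - 1)) h0).continuousWithinAt.tendsto.mono_left hle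
    simpa using this
  have hden : Tendsto (fun x : ℝ => x ^ n) (𝓝[>] 0) (𝓝 0) := by
    have : Tendsto (fun x : ℝ => x ^ n) (𝓝 0) (𝓝 (0 ^ n)) := (continuous_pow n).tendsto 0
    rw [zero_pow (by omega)] at this
    exact this.mono_left nhdsWithin_le_nhds
  have hn0 : (n : ℝ) ≠ 0 := by positivity
  have hlim : Tendsto (fun x => x ^ (n - 1) * g x / (n * x ^ (n - 1))) (𝓝[>] 0)
      (𝓝 (g 0 / n)) := by
    refine (((hg 0 h0).tendsto.mono_left hle).div_const (n : ℝ)).congr' ?_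
    filter_upwards [self_mem_nhdsWithin] with x hx
    have : x ≠ 0 := ne_of_gt hx
    field_simp
  have key := HasDerivAt.lhopital_zero_nhdsGT
    (hev.mono fun x hx => hasDerivAt_integral_pow_mul hg (n - 1) hx)
    (Eventually.of_forall fun x => hasDerivAt_pow n x)
    (by
      filter_upwards [self_mem_nhdsWithin] with x hx
      have : x ≠ 0 := ne_of_gt hx
      positivity)
    hnum hden hlim
  have key' := key.const_mul (n : ℝ)
  rw [mul_div_cancel₀ _ hn0] at key'
  refine key'.congr' ?_
  filter_upwards [self_mem_nhdsWithin] with x hx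
  rw [radialMean_of_ne (ne_of_gt hx)]
  ring

lemma nhdsWithin_IcoE_zero_le (R : ℝ≥0∞) : 𝓝[IcoE R \ {0}] (0:ℝ) ≤ 𝓝[>] 0 :=
  nhdsWithin_mono _ fun _ hx => lt_of_le_of_ne hx.1.1 (Ne.symm hx.2)

lemma continuousOn_radialMean {R : ℝ≥0∞} {n : ℕ} (hn : 1 ≤ n) {g : ℝ → ℝ}
    (hg : ContinuousOn g (IcoE R)) : ContinuousOn (radialMean n g) (IcoE R) := by
  intro r hr
  rcases hr.1.eq_or_lt with rfl | hpos
  · rw [← continuousWithinAt_sdiff_self, ContinuousWithinAt, radialMean_zero]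
    have hR : 0 < R := by simpa using hr.2
    exact (tendsto_radialMean_zero hR hn hg).mono_left (nhdsWithin_IcoE_zero_le R)
  · exact (hasDerivAt_radialMean hn hg ⟨hpos, hr.2⟩).continuousAt.continuousWithinAt

lemma radialMean_pos {R : ℝ≥0∞} {n : ℕ} (hn : 1 ≤ n) {g : ℝ → ℝ}
    (hg : ContinuousOn g (IcoE R)) (hpos : ∀ r ∈ IcoE R, 0 < g r) {r : ℝ} (hr : r ∈ IcoE R) :
    0 < radialMean n g r := by
  rcases hr.1.eq_or_lt with rfl | hr0
  · rw [radialMean_zero]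
    exact hpos 0 hr
  · rw [radialMean_of_ne hr0.ne']
    have hint : 0 < ∫ s in (0:ℝ)..r, s ^ (n - 1) * g s := by
      refine intervalIntegral.intervalIntegral_pos_of_pos_on ?_ ?_ hr0
      · refine ContinuousOn.intervalIntegrable ?_
        rw [uIcc_of_le hr.1]
        exact (continuousOn_pow_mul hg _).mono (Icc_subset_IcoE hr)
      · exact fun x hx => mul_pos (pow_pos hx.1 _)
          (hpos x (Icc_subset_IcoE hr ⟨hx.1.le, hx.2.le⟩))
    positivity

/-- The function `r ↦ r * (radialMean n g r) ^ q` is continuously differentiable on `[0, R)`,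
with the derivative given here. -/
lemma hasDerivWithinAt_mul_radialMean_rpow {R : ℝ≥0∞} {n : ℕ} (hn : 1 ≤ n) {g : ℝ → ℝ}
    (hg : ContinuousOn g (IcoE R)) (hpos : ∀ r ∈ IcoE R, 0 < g r) (q : ℝ) {r : ℝ}
    (hr : r ∈ IcoE R) :
    HasDerivWithinAt (fun r => r * radialMean n g r ^ q)
      (radialMean n g r ^ q +
        n * q * radialMean n g r ^ (q - 1) * (g r - radialMean n g r)) (IcoE R) r := by
  have hM := radialMean_pos hn hg hpos hr
  rcases hr.1.eq_or_lt with rfl | hr0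
  · rw [hasDerivWithinAt_iff_tendsto_slope]
    have hc := (continuousOn_radialMean hn hg 0 hr).rpow_const (p := q) (Or.inl hM.ne')
    have ht := hc.tendsto.mono_left (nhdsWithin_mono 0 (sdiff_subset (s := IcoE R) (t := {0})))
    have hval : radialMean n g 0 ^ q +
        n * q * radialMean n g 0 ^ (q - 1) * (g 0 - radialMean n g 0) = radialMean n g 0 ^ q := by
      rw [radialMean_zero]
      ring
    rw [hval]
    refine ht.congr' ?_
    filter_upwards [self_mem_nhdsWithin] with x hx
    have hx0 : x ≠ 0 := hx.2
    rw [slope_def_field]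
    field_simp
    simp
  · have hd := (hasDerivAt_id r).mul
      ((hasDerivAt_radialMean hn hg ⟨hr0, hr.2⟩).rpow_const (p := q) (Or.inl hM.ne'))
    refine (hd.congr_deriv ?_).hasDerivWithinAt
    have : r ≠ 0 := hr0.ne'
    simp only [id]
    field_simp

lemma IsCauchySol.eq_mul_radialMean_rpow {n k : ℕ} (hk : 1 ≤ k) {A f : ℝ → ℝ} {a : ℝ} {R : ℝ≥0∞}
    {φ : ℝ → ℝ} (hφ : IsCauchySol n k A f a R φ)
    {r : ℝ} (hr : r ∈ IooE R)
    (hM : 0 ≤ radialMean n (fun s => f (φ s) ^ k / (n.choose k : ℝ)) r) :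
    A |deriv φ r| * deriv φ r =
      r * radialMean n (fun s => f (φ s) ^ k / (n.choose k : ℝ)) r ^ ((1:ℝ) / k) := by
  have hr0 : 0 < r := hr.1
  have hbase : n * r ^ ((k:ℝ) - n) / (n.choose k) * (∫ s in (0:ℝ)..r, s ^ (n-1) * f (φ s) ^ k) =
      r ^ k * radialMean n (fun s => f (φ s) ^ k / (n.choose k : ℝ)) r := by
    simp_rw [radialMean_of_ne hr0.ne', ← mul_div_assoc, intervalIntegral.integral_div,
      Real.rpow_sub hr0, Real.rpow_natCast]
    ring
  rw [hφ.2.2.2.2.2 r hr, hbase, Real.mul_rpow (by positivity) hM, one_div,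
    Real.pow_rpow_inv_natCast hr0.le (by omega)]

/-- If `A(|p|) p > 0` with `A > 0` on `(0, ∞)`, then `p > 0`. -/
lemma pos_of_mul_abs_pos {A : ℝ → ℝ} (hA : ∀ p ∈ Ioi (0:ℝ), 0 < A p) {p : ℝ}
    (hp : 0 < A |p| * p) : 0 < p := by
  have hne : p ≠ 0 := by
    rintro rfl
    simp at hp
  exact (mul_pos_iff_of_pos_left (hA |p| (abs_pos.2 hne))).1 hp

/-- From the proof of Lemma 2.1: lim_{r→0⁺} A(φ′(r))φ′(r)/r = (f(a)^k / C(n,k))^{1/k}, and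
h(r) = ∫₀^r A(|φ′|)φ′ is C²[0,R) with h′(0) = 0 and h″(0) = (f(a)^k / C(n,k))^{1/k}. -/
theorem cauchySol_second_order_at_zero
    (n k : ℕ) (hk : 1 ≤ k) (hkn : k ≤ n) (A f : ℝ → ℝ)
    (hA : Cond103 A) (hf : Cond109 f)
    (a : ℝ) (ha : 0 < a) (R : ℝ≥0∞) (hR : 0 < R)
    (φ : ℝ → ℝ) (hφ : IsCauchySol n k A f a R φ) :
    Tendsto (fun r => A (deriv φ r) * deriv φ r / r) (𝓝[>] 0)
      (𝓝 ((f a ^ k / (n.choose k : ℝ)) ^ ((1:ℝ)/k))) ∧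
    ∃ h1 h2 : ℝ → ℝ,
      (∀ r ∈ IcoE R,
        HasDerivWithinAt (fun ρ => ∫ s in (0:ℝ)..ρ, A |deriv φ s| * deriv φ s) (h1 r) (IcoE R) r) ∧
      (∀ r ∈ IcoE R, HasDerivWithinAt h1 (h2 r) (IcoE R) r) ∧
      ContinuousOn h1 (IcoE R) ∧ ContinuousOn h2 (IcoE R) ∧
      h1 0 = 0 ∧ h2 0 = (f a ^ k / (n.choose k : ℝ)) ^ ((1:ℝ)/k) := by
  have hn : 1 ≤ n := hk.trans hkn
  have h0 : (0:ℝ) ∈ IcoE R := ⟨le_rfl, by simpa using hR⟩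
  have hC : (0:ℝ) < n.choose k := by exact_mod_cast Nat.choose_pos hkn
  set g : ℝ → ℝ := fun s => f (φ s) ^ k / (n.choose k : ℝ) with hgdef
  have hg : ContinuousOn g (IcoE R) :=
    ((hf.1.comp hφ.1 hφ.2.2.2.2.1).pow k).div_const _
  have hgpos : ∀ r ∈ IcoE R, 0 < g r := fun r hr =>
    div_pos (pow_pos (hf.2.1 _ (hφ.2.2.2.2.1 r hr)) k) hC
  have hg0 : g 0 = f a ^ k / (n.choose k : ℝ) := by rw [hgdef, ← hφ.2.2.2.1]
  have hMpos : ∀ r ∈ IcoE R, 0 < radialMean n g r := fun r hr => radialMean_pos hn hg hgpos hr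
  have hM : ContinuousOn (radialMean n g) (IcoE R) := continuousOn_radialMean hn hg
  have hW : ∀ r ∈ IooE R,
      A |deriv φ r| * deriv φ r = r * radialMean n g r ^ ((1:ℝ) / k) := fun r hr =>
    hφ.eq_mul_radialMean_rpow hk hr (hMpos r ⟨hr.1.le, hr.2⟩).le
  have hMq : ∀ q : ℝ, ContinuousOn (fun r => radialMean n g r ^ q) (IcoE R) := fun q =>
    hM.rpow_const fun r hr => Or.inl (hMpos r hr).ne'
  have hh1 : ContinuousOn (fun r => r * radialMean n g r ^ ((1:ℝ) / k)) (IcoE R) :=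
    continuousOn_id.mul (hMq _)
  rw [← hg0]
  refine ⟨?_, fun r => r * radialMean n g r ^ ((1:ℝ) / k), _, ?_,
    fun r hr => hasDerivWithinAt_mul_radialMean_rpow hn hg hgpos _ hr, hh1, ?_, by simp, ?_⟩
  · refine ((tendsto_radialMean_zero hR hn hg).rpow_const
      (Or.inl (hgpos 0 h0).ne')).congr' ?_
    obtain ⟨b, hb, hsub⟩ := exists_gt_Icc_subset_IcoE h0
    filter_upwards [Ioo_mem_nhdsGT hb] with x hx
    have hxR := hsub ⟨hx.1.le, hx.2.le⟩
    have hx0 : 0 < x := hx.1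
    have hWx := hW x ⟨hx0, hxR.2⟩
    have hφ' : 0 < deriv φ x := by
      refine pos_of_mul_abs_pos hA.2.1 ?_
      rw [hWx]
      exact mul_pos hx0 (Real.rpow_pos_of_pos (hMpos x hxR) _)
    rw [abs_of_pos hφ'] at hWx
    rw [hWx, mul_div_cancel_left₀ _ hx0.ne']
  · intro r hr
    have heq : ∀ ρ ∈ IcoE R, (∫ s in (0:ℝ)..ρ, A |deriv φ s| * deriv φ s) =
        ∫ s in (0:ℝ)..ρ, s * radialMean n g s ^ ((1:ℝ) / k) := fun ρ hρ => by
      refine intervalIntegral.integral_congr_ae (Eventually.of_forall fun s hs => ?_)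
      rw [uIoc_of_le hρ.1] at hs
      exact hW s ⟨hs.1, (Icc_subset_IcoE hρ ⟨hs.1.le, hs.2⟩).2⟩
    exact (hasDerivWithinAt_integral_IcoE hh1 hr).congr heq (heq r hr)
  · exact (hMq _).add ((continuousOn_const.mul (hMq _)).mul (hg.sub hM))
  · simp [radialMean_zero]
end
end

section
/- Assume A satisfies condition (103) with lim_{p→∞} pA(p) = ∞, and f satisfies condition (109). Let a > 0 and 0 < R < ∞, and let φ be a positive solution of the Cauchy problem (204) on [0,R) such that φ(r) → ∞ as r → R⁻. Then ∫_a^∞ (Ψ⁻¹((n R^{k−1}/C(n,k)) ∫_a^s f(t)^k dt))^{−1} ds ≤ R < ∞. -/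
open Filter MeasureTheory Set Topology
open scoped ENNReal

noncomputable section

/-- Under `Cond103` the map `p ↦ p A(p)` is strictly increasing on `[0,∞)`. -/
lemma Cond103.strictMonoOn_Ici {A : ℝ → ℝ} (hA : Cond103 A) :
    StrictMonoOn (fun p => p * A p) (Ici 0) := by
  intro p hp q hq hpq
  rcases (mem_Ici.1 hp).eq_or_lt with rfl | hp0
  · simpa using mul_pos hpq (hA.2.1 q hpq)
  · exact hA.2.2.2 hp0 (hp0.trans hpq) hpq

lemma Cond103.mul_nonneg {A : ℝ → ℝ} (hA : Cond103 A) {p : ℝ} (hp : 0 ≤ p) : 0 ≤ p * A p := by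
  simpa using hA.strictMonoOn_Ici.monotoneOn self_mem_Ici hp hp

lemma Cond103.strictMonoOn_pow {A : ℝ → ℝ} (hA : Cond103 A) {k : ℕ} (hk : 1 ≤ k) :
    StrictMonoOn (fun p => (p * A p) ^ k) (Ici 0) := fun _ hp _ hq hpq =>
  pow_lt_pow_left₀ (hA.strictMonoOn_Ici hp hq hpq) (hA.mul_nonneg hp) (by omega)

lemma Cond103.continuousOn_pow {A : ℝ → ℝ} (hA : Cond103 A) (k : ℕ) :
    ContinuousOn (fun p => (p * A p) ^ k) (Ici 0) := hA.2.2.1.pow k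

lemma Cond103.intervalIntegrable_pow {A : ℝ → ℝ} (hA : Cond103 A) (k : ℕ) {p q : ℝ}
    (hp : 0 ≤ p) (hq : 0 ≤ q) :
    IntervalIntegrable (fun t => (t * A t) ^ k) volume p q :=
  ((hA.continuousOn_pow k).mono fun _ hx => (le_min hp hq).trans hx.1).intervalIntegrable

/-- A monotone function on `[0,∞)` satisfies `(q - p) G(p) ≤ ∫_p^q G` for every order of the
endpoints. -/
lemma sub_mul_le_integral_of_monotoneOn {G : ℝ → ℝ} (hG : MonotoneOn G (Ici 0)) {p q : ℝ}
    (hp : 0 ≤ p) (hq : 0 ≤ q) (hi : IntervalIntegrable G volume p q) :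
    (q - p) * G p ≤ ∫ t in p..q, G t := by
  rcases le_total p q with h | h
  · have := intervalIntegral.integral_mono_on (f := fun _ => G p) (g := G) h
      intervalIntegrable_const hi fun x hx => hG hp (hp.trans hx.1) hx.1
    simpa using this
  · have := intervalIntegral.integral_mono_on (f := G) (g := fun _ => G p) h
      hi.symm intervalIntegrable_const fun x hx => hG (hq.trans hx.1) hp hx.2
    rw [intervalIntegral.integral_symm]
    simp only [intervalIntegral.integral_const, smul_eq_mul] at this
    linarith

lemma Psi_sub_le {A : ℝ → ℝ} (hA : Cond103 A) {k : ℕ} (hk : 1 ≤ k) {p q : ℝ}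
    (hp : 0 ≤ p) (hq : 0 ≤ q) :
    Psi A k q - Psi A k p ≤ q * ((q * A q) ^ k - (p * A p) ^ k) := by
  have h := sub_mul_le_integral_of_monotoneOn (hA.strictMonoOn_pow hk).monotoneOn hp hq
    (hA.intervalIntegrable_pow k hp hq)
  have hsplit := intervalIntegral.integral_add_adjacent_intervals
    (hA.intervalIntegrable_pow k le_rfl hp) (hA.intervalIntegrable_pow k hp hq)
  simp only [Psi] at *
  linarith

lemma Psi_zero (A : ℝ → ℝ) (k : ℕ) : Psi A k 0 = 0 := by simp [Psi]

lemma Psi_strictMonoOn {A : ℝ → ℝ} (hA : Cond103 A) {k : ℕ} (hk : 1 ≤ k) :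
    StrictMonoOn (Psi A k) (Ici 0) := by
  have hmono : ∀ {p q : ℝ}, 0 ≤ p → p < q → p * ((q * A q) ^ k - (p * A p) ^ k) ≤
      Psi A k q - Psi A k p := fun hp hpq => by
    linarith [Psi_sub_le hA hk (hp.trans hpq.le) hp]
  have hpos : ∀ {p q : ℝ}, 0 < p → p < q → Psi A k p < Psi A k q := fun {p q} hp hpq => by
    have h := hA.strictMonoOn_pow hk hp.le (hp.trans hpq).le hpq
    linarith [hmono hp.le hpq, mul_pos hp (sub_pos.2 h)]
  intro p hp q _ hpq
  rcases (mem_Ici.1 hp).eq_or_lt with rfl | hp0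
  · have h := hmono le_rfl (half_pos hpq)
    linarith [hpos (half_pos hpq) (half_lt_self hpq)]
  · exact hpos hp0 hpq

lemma Psi_continuousOn {A : ℝ → ℝ} (hA : Cond103 A) (k : ℕ) {M : ℝ} (hM : 0 ≤ M) :
    ContinuousOn (Psi A k) (Icc 0 M) := by
  have hG : ContinuousOn (fun p => (p * A p) ^ k) (Icc 0 M) :=
    (hA.continuousOn_pow k).mono Icc_subset_Ici_self
  refine (continuousOn_id.mul hG).sub ?_
  have h := intervalIntegral.continuousOn_primitive_interval (μ := volume) (a := 0) (b := M)
    (f := fun p => (p * A p) ^ k) (by rw [uIcc_of_le hM]; exact hG.integrableOn_Icc)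
  rwa [uIcc_of_le hM] at h

lemma Psi_surjOn {A : ℝ → ℝ} (hA : Cond103 A) (hinf : Tendsto (fun p => p * A p) atTop atTop)
    {k : ℕ} (hk : 1 ≤ k) : SurjOn (Psi A k) (Ici 0) (Ici 0) := by
  intro y hy
  have hlim : Tendsto (fun p => (p * A p) ^ k) atTop atTop :=
    (tendsto_pow_atTop (by omega)).comp hinf
  obtain ⟨M, hMy, hM⟩ := ((hlim.eventually_ge_atTop (y + (1 * A 1) ^ k)).and
    (eventually_ge_atTop (1 : ℝ))).exists
  have hM0 : (0 : ℝ) ≤ M := zero_le_one.trans hM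
  have h1 := Psi_sub_le hA hk hM0 zero_le_one
  have h2 := (Psi_strictMonoOn hA hk).monotoneOn self_mem_Ici (mem_Ici.2 zero_le_one) zero_le_one
  rw [Psi_zero] at h2
  obtain ⟨p, hp, hpy⟩ := intermediate_value_Icc hM0 (Psi_continuousOn hA k hM0)
    (show y ∈ Icc (Psi A k 0) (Psi A k M) from
      ⟨by simpa [Psi_zero] using hy, by linarith⟩)
  exact ⟨p, hp.1, hpy⟩

lemma le_PsiInv {A : ℝ → ℝ} (hA : Cond103 A) (hinf : Tendsto (fun p => p * A p) atTop atTop)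
    {k : ℕ} (hk : 1 ≤ k) {p y : ℝ} (hp : 0 ≤ p) (hpy : Psi A k p ≤ y) : p ≤ PsiInv A k y := by
  have hmono := Psi_strictMonoOn hA hk
  have hy : 0 ≤ y := by
    have := hmono.monotoneOn self_mem_Ici hp hp
    rw [Psi_zero] at this
    linarith
  have hex := Psi_surjOn hA hinf hk hy
  refine (hmono.le_iff_le hp (Function.invFunOn_mem hex)).1 ?_
  exact hpy.trans_eq (Function.invFunOn_eq hex).symm

/-- If `u` is continuous at `r` and `(u A(u))^k` is differentiable there, then `Ψ ∘ u` is
differentiable at `r`, even though `u` need not be. -/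
lemma hasDerivAt_Psi_comp {A : ℝ → ℝ} (hA : Cond103 A) {k : ℕ} (hk : 1 ≤ k) {u : ℝ → ℝ}
    {r w' : ℝ} (hu : ∀ᶠ s in 𝓝 r, 0 ≤ u s) (hc : ContinuousAt u r)
    (hw : HasDerivAt (fun s => (u s * A (u s)) ^ k) w' r) :
    HasDerivAt (fun s => Psi A k (u s)) (u r * w') r := by
  have hr : 0 ≤ u r := hu.self_of_nhds
  have hw1 := hw.const_mul (u r)
  have hsmall : (fun s => (u s - u r) * ((u s * A (u s)) ^ k - (u r * A (u r)) ^ k))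
      =o[𝓝 r] fun s => s - r := by
    have h1 : (fun s => u s - u r) =o[𝓝 r] fun _ => (1 : ℝ) := by
      rw [Asymptotics.isLittleO_one_iff]
      simpa using hc.tendsto.sub_const (u r)
    simpa using h1.mul_isBigO hw.isBigO_sub
  rw [hasDerivAt_iff_isLittleO] at hw1 ⊢
  have hdiff : (fun s => Psi A k (u s) - Psi A k (u r) -
      u r * ((u s * A (u s)) ^ k - (u r * A (u r)) ^ k)) =o[𝓝 r] fun s => s - r := by
    refine (Asymptotics.IsBigO.of_bound 1 ?_).trans_isLittleO hsmall
    filter_upwards [hu] with s hs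
    have h1 := Psi_sub_le hA hk hr hs
    have h2 := Psi_sub_le hA hk hs hr
    rw [one_mul, Real.norm_eq_abs, Real.norm_eq_abs]
    exact abs_le_abs_of_nonneg (by linarith) (by linarith)
  refine (hdiff.add hw1).congr_left fun s => ?_
  ring

lemma IcoE_ofReal {R : ℝ} (hR : 0 < R) : IcoE (ENNReal.ofReal R) = Ico 0 R := by
  ext r
  simp [IcoE, ENNReal.ofReal_lt_ofReal_iff hR]

lemma IooE_ofReal {R : ℝ} (hR : 0 < R) : IooE (ENNReal.ofReal R) = Ioo 0 R := by
  ext r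
  simp [IooE, ENNReal.ofReal_lt_ofReal_iff hR]

section CauchySolution

variable {n k : ℕ} {A f φ : ℝ → ℝ} {a R : ℝ}

lemma IsCauchySol.continuousOn_integrand (hf : Cond109 f) (hR : 0 < R)
    (hφ : IsCauchySol n k A f a (ENNReal.ofReal R) φ) :
    ContinuousOn (fun s => s ^ (n - 1) * f (φ s) ^ k) (Ico 0 R) := by
  obtain ⟨hcont, -, -, -, hpos, -⟩ := hφ
  rw [IcoE_ofReal hR] at hcont hpos
  exact (continuousOn_id.pow _).mul ((hf.1.comp hcont hpos).pow k)

lemma IsCauchySol.intervalIntegrable_integrand (hf : Cond109 f) (hR : 0 < R)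
    (hφ : IsCauchySol n k A f a (ENNReal.ofReal R) φ) {r : ℝ} (hr : r ∈ Ioo 0 R) :
    IntervalIntegrable (fun s => s ^ (n - 1) * f (φ s) ^ k) volume 0 r := by
  refine ((hφ.continuousOn_integrand hf hR).mono ?_).intervalIntegrable
  rw [uIcc_of_le hr.1.le]
  exact fun x hx => ⟨hx.1, hx.2.trans_lt hr.2⟩

lemma IsCauchySol.integral_pos (hf : Cond109 f) (hR : 0 < R)
    (hφ : IsCauchySol n k A f a (ENNReal.ofReal R) φ) {r : ℝ} (hr : r ∈ Ioo 0 R) :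
    0 < ∫ s in (0:ℝ)..r, s ^ (n - 1) * f (φ s) ^ k := by
  refine intervalIntegral.intervalIntegral_pos_of_pos_on
    (hφ.intervalIntegrable_integrand hf hR hr) (fun x hx => ?_) hr.1
  have hx' : x ∈ IcoE (ENNReal.ofReal R) := by
    rw [IcoE_ofReal hR]
    exact ⟨hx.1.le, hx.2.trans hr.2⟩
  exact mul_pos (pow_pos hx.1 _) (pow_pos (hf.2.1 _ (hφ.2.2.2.2.1 x hx')) _)

lemma choose_coeff_pos (hk : 1 ≤ k) (hkn : k ≤ n) : 0 < (n : ℝ) / n.choose k :=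
  div_pos (by exact_mod_cast hk.trans hkn) (by exact_mod_cast Nat.choose_pos hkn)

lemma IsCauchySol.rhs_pos (hk : 1 ≤ k) (hkn : k ≤ n) (hf : Cond109 f) (hR : 0 < R)
    (hφ : IsCauchySol n k A f a (ENNReal.ofReal R) φ) {r : ℝ} (hr : r ∈ Ioo 0 R) :
    0 < n * r ^ ((k:ℝ) - n) / (n.choose k) * ∫ s in (0:ℝ)..r, s ^ (n-1) * f (φ s) ^ k := by
  rw [mul_div_right_comm]
  exact mul_pos (mul_pos (choose_coeff_pos hk hkn) (Real.rpow_pos_of_pos hr.1 _))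
    (hφ.integral_pos hf hR hr)

lemma IsCauchySol.deriv_pos (hk : 1 ≤ k) (hkn : k ≤ n) (hA : Cond103 A) (hf : Cond109 f)
    (hR : 0 < R) (hφ : IsCauchySol n k A f a (ENNReal.ofReal R) φ) {r : ℝ}
    (hr : r ∈ Ioo 0 R) : 0 < deriv φ r := by
  have heq := hφ.2.2.2.2.2 r (by rwa [IooE_ofReal hR])
  have hpos := Real.rpow_pos_of_pos (hφ.rhs_pos hk hkn hf hR hr) ((1:ℝ)/k)
  rw [← heq] at hpos
  by_contra! hle
  rcases hle.eq_or_lt with h0 | hneg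
  · simp [h0] at hpos
  · have := mul_neg_of_pos_of_neg (hA.2.1 _ (abs_pos.2 hneg.ne)) hneg
    linarith

lemma IsCauchySol.pow_eq (hk : 1 ≤ k) (hkn : k ≤ n) (hA : Cond103 A) (hf : Cond109 f)
    (hR : 0 < R) (hφ : IsCauchySol n k A f a (ENNReal.ofReal R) φ) {r : ℝ}
    (hr : r ∈ Ioo 0 R) : (deriv φ r * A (deriv φ r)) ^ k =
      n / (n.choose k) * (r ^ ((k:ℝ) - n) * ∫ s in (0:ℝ)..r, s ^ (n-1) * f (φ s) ^ k) := by
  have heq := hφ.2.2.2.2.2 r (by rwa [IooE_ofReal hR])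
  rw [abs_of_pos (hφ.deriv_pos hk hkn hA hf hR hr), mul_comm] at heq
  rw [heq, one_div, Real.rpow_inv_natCast_pow (hφ.rhs_pos hk hkn hf hR hr).le (by omega)]
  ring

lemma rpow_sub_mul_pow {r : ℝ} (hr : 0 < r) :
    r ^ ((k:ℝ) - n) * r ^ n = r ^ k := by
  rw [← Real.rpow_natCast r n, ← Real.rpow_add hr, sub_add_cancel, Real.rpow_natCast]

lemma IsCauchySol.strictMonoOn (hk : 1 ≤ k) (hkn : k ≤ n) (hA : Cond103 A) (hf : Cond109 f)
    (hR : 0 < R) (hφ : IsCauchySol n k A f a (ENNReal.ofReal R) φ) :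
    StrictMonoOn φ (Ico 0 R) := by
  refine strictMonoOn_of_deriv_pos (convex_Ico 0 R) (IcoE_ofReal hR ▸ hφ.1) fun r hr => ?_
  rw [interior_Ico] at hr
  exact hφ.deriv_pos hk hkn hA hf hR hr

lemma IsCauchySol.exists_hasDerivAt_pow (hk : 1 ≤ k) (hkn : k ≤ n) (hA : Cond103 A)
    (hf : Cond109 f) (hR : 0 < R) (hφ : IsCauchySol n k A f a (ENNReal.ofReal R) φ) {r : ℝ}
    (hr : r ∈ Ioo 0 R) :
    ∃ w', HasDerivAt (fun s => (deriv φ s * A (deriv φ s)) ^ k) w' r ∧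
      w' ≤ n * R ^ (k - 1) / (n.choose k) * f (φ r) ^ k := by
  have hcont := hφ.continuousOn_integrand hf hR
  have hnhds : Ioo 0 R ∈ 𝓝 r := isOpen_Ioo.mem_nhds hr
  have hI := intervalIntegral.integral_hasDerivAt_right
    (hφ.intervalIntegrable_integrand hf hR hr)
    ((hcont.mono Ioo_subset_Ico_self).stronglyMeasurableAtFilter isOpen_Ioo r hr)
    ((hcont.mono Ioo_subset_Ico_self).continuousAt hnhds)
  have hpow := Real.hasDerivAt_rpow_const (x := r) (p := (k:ℝ) - n) (Or.inl hr.1.ne')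
  refine ⟨_, ((hpow.mul hI).const_mul ((n : ℝ) / n.choose k)).congr_of_eventuallyEq ?_, ?_⟩
  · filter_upwards [hnhds] with s hs
    exact hφ.pow_eq hk hkn hA hf hR hs
  · have hc := choose_coeff_pos hk hkn
    have hfk : 0 ≤ f (φ r) ^ k := pow_nonneg (hf.2.1 _ (hφ.2.2.2.2.1 r (by
      rw [IcoE_ofReal hR]; exact ⟨hr.1.le, hr.2⟩))).le _
    have h1 : ((k:ℝ) - n) * r ^ ((k:ℝ) - n - 1) *
        (∫ s in (0:ℝ)..r, s ^ (n-1) * f (φ s) ^ k) ≤ 0 := by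
      refine mul_nonpos_of_nonpos_of_nonneg (mul_nonpos_of_nonpos_of_nonneg ?_
        (Real.rpow_nonneg hr.1.le _)) (hφ.integral_pos hf hR hr).le
      exact sub_nonpos.2 (by exact_mod_cast hkn)
    have h2 : r ^ ((k:ℝ) - n) * r ^ (n - 1) = r ^ (k - 1) := by
      have h := rpow_sub_mul_pow (k := k - 1) (n := n - 1) hr.1
      rwa [Nat.cast_sub hk, Nat.cast_sub (hk.trans hkn), sub_sub_sub_cancel_right] at h
    have h3 : r ^ (k - 1) * f (φ r) ^ k ≤ R ^ (k - 1) * f (φ r) ^ k :=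
      mul_le_mul_of_nonneg_right (pow_le_pow_left₀ hr.1.le hr.2.le _) hfk
    rw [mul_div_right_comm, mul_assoc (_ / _) (R ^ (k - 1))]
    refine mul_le_mul_of_nonneg_left ?_ hc.le
    rw [← mul_assoc (r ^ _) (r ^ _), h2]
    linarith

/-- The flux `(φ' A(φ'))^k` vanishes at the origin. -/
lemma IsCauchySol.tendsto_pow_zero (hk : 1 ≤ k) (hkn : k ≤ n) (hA : Cond103 A)
    (hf : Cond109 f) (hR : 0 < R) (hφ : IsCauchySol n k A f a (ENNReal.ofReal R) φ) :
    Tendsto (fun s => (deriv φ s * A (deriv φ s)) ^ k) (𝓝[>] 0) (𝓝 0) := by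
  have hmono := hφ.strictMonoOn hk hkn hA hf hR
  have hpos := hφ.2.2.2.2.1
  rw [IcoE_ofReal hR] at hpos
  have hc := choose_coeff_pos hk hkn
  have hlim : Tendsto (fun s : ℝ => n / (n.choose k) * (s ^ k * f (φ (R / 2)) ^ k))
      (𝓝[>] 0) (𝓝 0) := by
    have h : Continuous fun s : ℝ => n / (n.choose k) * (s ^ k * f (φ (R / 2)) ^ k) := by
      fun_prop
    have h0 := h.tendsto 0
    simp only [zero_pow (show k ≠ 0 by omega), zero_mul, mul_zero] at h0
    exact h0.mono_left nhdsWithin_le_nhds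
  have hev : ∀ᶠ s in 𝓝[>] (0:ℝ), s ∈ Ioo 0 (R / 2) := Ioo_mem_nhdsGT (half_pos hR)
  refine tendsto_of_tendsto_of_tendsto_of_le_of_le' tendsto_const_nhds hlim ?_ ?_
  · filter_upwards [hev] with s hs
    exact pow_nonneg (hA.mul_nonneg
      (hφ.deriv_pos hk hkn hA hf hR ⟨hs.1, by linarith [hs.2]⟩).le) k
  · filter_upwards [hev] with s hs
    have hsR : s ∈ Ioo 0 R := ⟨hs.1, by linarith [hs.2]⟩
    have hhalf : R / 2 ∈ Ico 0 R := ⟨by linarith, by linarith⟩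
    have hint : (∫ t in (0:ℝ)..s, t ^ (n-1) * f (φ t) ^ k) ≤
        s ^ n * f (φ (R / 2)) ^ k := by
      have h := intervalIntegral.integral_mono_on
        (g := fun _ => s ^ (n - 1) * f (φ (R / 2)) ^ k) hs.1.le
        (hφ.intervalIntegrable_integrand hf hR hsR) intervalIntegrable_const fun t ht => by
          have htR : t ∈ Ico 0 R := ⟨ht.1, ht.2.trans_lt hsR.2⟩
          refine mul_le_mul (pow_le_pow_left₀ ht.1 ht.2 _)
            (pow_le_pow_left₀ (hf.2.1 _ (hpos t htR)).le ?_ _)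
            (pow_nonneg (hf.2.1 _ (hpos t htR)).le _) (pow_nonneg hs.1.le _)
          exact hf.2.2 (hpos t htR) (hpos _ hhalf)
            (hmono.monotoneOn htR hhalf (ht.2.trans hs.2.le))
      refine h.trans_eq ?_
      rw [intervalIntegral.integral_const, sub_zero, smul_eq_mul, ← mul_assoc,
        mul_pow_sub_one (by omega)]
    rw [hφ.pow_eq hk hkn hA hf hR hsR]
    refine mul_le_mul_of_nonneg_left ?_ hc.le
    rw [← rpow_sub_mul_pow (n := n) hs.1, mul_assoc]
    exact mul_le_mul_of_nonneg_left hint (Real.rpow_nonneg hs.1.le _)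

/-- First integral of the Cauchy problem. -/
lemma IsCauchySol.Psi_deriv_le (hk : 1 ≤ k) (hkn : k ≤ n) (hA : Cond103 A)
    (hf : Cond109 f) (ha : 0 < a) (hR : 0 < R)
    (hφ : IsCauchySol n k A f a (ENNReal.ofReal R) φ) {r : ℝ} (hr : r ∈ Ioo 0 R) :
    Psi A k (deriv φ r) ≤ n * R ^ (k - 1) / (n.choose k) * ∫ t in a..φ r, f t ^ k := by
  set K : ℝ := n * R ^ (k - 1) / (n.choose k)
  have hmono := hφ.strictMonoOn hk hkn hA hf hR
  have hpos := hφ.2.2.2.2.1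
  have hdiff := hφ.2.1
  have hdcont := hφ.2.2.1
  rw [IcoE_ofReal hR] at hpos
  rw [IooE_ofReal hR] at hdiff hdcont
  have hderiv_pos : ∀ s ∈ Ioo 0 R, 0 < deriv φ s := fun s hs =>
    hφ.deriv_pos hk hkn hA hf hR hs
  have hfcont : ContinuousOn (fun t => f t ^ k) (Ioi 0) := hf.1.pow k
  have hD : ∀ s ∈ Ioo 0 R, ∃ d, 0 ≤ d ∧
      HasDerivAt (fun s => K * (∫ t in a..φ s, f t ^ k) - Psi A k (deriv φ s)) d s := by
    intro s hs
    have hsnhds : Ioo 0 R ∈ 𝓝 s := isOpen_Ioo.mem_nhds hs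
    have hφs : 0 < φ s := hpos s ⟨hs.1.le, hs.2⟩
    obtain ⟨w', hw, hle⟩ := hφ.exists_hasDerivAt_pow hk hkn hA hf hR hs
    have hPsi := hasDerivAt_Psi_comp hA hk
      (by filter_upwards [hsnhds] with t ht using (hderiv_pos t ht).le)
      (hdcont.continuousAt hsnhds) hw
    have hF := intervalIntegral.integral_hasDerivAt_right (a := a) (b := φ s)
      (hfcont.mono fun x hx => (lt_min ha hφs).trans_le hx.1).intervalIntegrable
      (hfcont.stronglyMeasurableAtFilter isOpen_Ioi _ hφs)
      (hfcont.continuousAt (Ioi_mem_nhds hφs))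
    have hFφ := (hF.comp s (hdiff s hs).hasDerivAt).const_mul K
    refine ⟨_, ?_, hFφ.sub hPsi⟩
    have := mul_le_mul_of_nonneg_left hle (hderiv_pos s hs).le
    linarith
  have hDmono : MonotoneOn
      (fun s => K * (∫ t in a..φ s, f t ^ k) - Psi A k (deriv φ s)) (Ioo 0 R) := by
    refine monotoneOn_of_deriv_nonneg (convex_Ioo 0 R) ?_ ?_ ?_
    · intro s hs
      obtain ⟨d, -, h⟩ := hD s hs
      exact h.continuousAt.continuousWithinAt
    · intro s hs
      rw [interior_Ioo] at hs
      obtain ⟨d, -, h⟩ := hD s hs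
      exact h.differentiableAt.differentiableWithinAt
    · intro s hs
      rw [interior_Ioo] at hs
      obtain ⟨d, h0, h⟩ := hD s hs
      rwa [h.deriv]
  have hw0 := hφ.tendsto_pow_zero hk hkn hA hf hR
  have hG1 : (0:ℝ) < (1 * A 1) ^ k := by
    simpa using pow_pos (hA.2.1 1 (mem_Ioi.2 one_pos)) k
  rw [← sub_nonneg]
  refine le_of_tendsto (x := 𝓝[>] (0:ℝ)) (f := fun s => -(deriv φ s * A (deriv φ s)) ^ k)
    (by simpa using hw0.neg) ?_
  filter_upwards [hw0.eventually_lt_const hG1, Ioo_mem_nhdsGT hr.1] with s hs1 hsr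
  have hs : s ∈ Ioo 0 R := ⟨hsr.1, hsr.2.trans hr.2⟩
  have hle1 : deriv φ s < 1 :=
    ((hA.strictMonoOn_pow hk).lt_iff_lt (hderiv_pos s hs).le (mem_Ici.2 zero_le_one)).1 hs1
  have hPsi := Psi_sub_le hA hk le_rfl (hderiv_pos s hs).le
  rw [Psi_zero, zero_mul, zero_pow (by omega), sub_zero, sub_zero] at hPsi
  have hwpos : 0 ≤ (deriv φ s * A (deriv φ s)) ^ k :=
    pow_nonneg (hA.mul_nonneg (hderiv_pos s hs).le) k
  have haφ : a ≤ φ s := by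
    rw [← hφ.2.2.2.1]
    exact hmono.monotoneOn ⟨le_rfl, hR⟩ ⟨hs.1.le, hs.2⟩ hs.1.le
  have hFpos : 0 ≤ K * ∫ t in a..φ s, f t ^ k := by
    refine mul_nonneg (by positivity) (intervalIntegral.integral_nonneg haφ fun t ht => ?_)
    exact pow_nonneg (hf.2.1 t (ha.trans_le ht.1)).le k
  refine le_trans ?_ (hDmono hs hr hsr.2.le)
  have := mul_le_mul_of_nonneg_right hle1.le hwpos
  linarith

lemma IsCauchySol.Ioi_subset_image (hR : 0 < R)
    (hφ : IsCauchySol n k A f a (ENNReal.ofReal R) φ)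
    (hblow : Tendsto φ (𝓝[<] R) atTop) : Ioi a ⊆ φ '' Ioo 0 R := by
  intro y hy
  obtain ⟨b, hby, hb⟩ := ((hblow.eventually_gt_atTop y).and (Ioo_mem_nhdsLT hR)).exists
  have hcont := hφ.1
  rw [IcoE_ofReal hR] at hcont
  obtain ⟨x, hx, hxy⟩ := intermediate_value_Ioo hb.1.le
    (hcont.mono fun x hx => ⟨hx.1, hx.2.trans_lt hb.2⟩)
    (show y ∈ Ioo (φ 0) (φ b) from ⟨by rw [hφ.2.2.2.1]; exact hy, hby⟩)
  exact ⟨x, ⟨hx.1, hx.2.trans hb.2⟩, hxy⟩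

end CauchySolution

/-- From the proof of Lemma 3.4: a positive solution of (204) on [0,R) blowing up at R
satisfies ∫_a^∞ (Ψ⁻¹((nR^{k−1}/C(n,k))∫_a^s f^k))⁻¹ ds ≤ R < ∞. -/
theorem blowup_cauchy_integral_bound
    (n k : ℕ) (hk : 1 ≤ k) (hkn : k ≤ n) (A f : ℝ → ℝ)
    (hA : Cond103 A)
    (hinf : Tendsto (fun p => p * A p) atTop atTop)
    (hf : Cond109 f)
    (a R : ℝ) (ha : 0 < a) (hR : 0 < R)
    (φ : ℝ → ℝ) (hφ : IsCauchySol n k A f a (ENNReal.ofReal R) φ)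
    (hblow : Tendsto φ (𝓝[<] R) atTop) :
    ∫⁻ s in Ioi a,
        ENNReal.ofReal
          (PsiInv A k ((n * R ^ (k-1) / (n.choose k : ℝ)) * ∫ t in a..s, f t ^ k))⁻¹
      ≤ ENNReal.ofReal R := by
  refine (lintegral_mono_set (hφ.Ioi_subset_image hR hblow)).trans ?_
  have hdiff := hφ.2.1
  rw [IooE_ofReal hR] at hdiff
  rw [lintegral_image_eq_lintegral_abs_deriv_mul measurableSet_Ioo
    (fun r hr => (hdiff r hr).hasDerivAt.hasDerivWithinAt)
    ((hφ.strictMonoOn hk hkn hA hf hR).injOn.mono Ioo_subset_Ico_self)]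
  have hone : ∫⁻ _ in Ioo 0 R, (1 : ℝ≥0∞) = ENNReal.ofReal R := by simp
  rw [← hone]
  refine setLIntegral_mono' measurableSet_Ioo fun r hr => ?_
  have hpos := hφ.deriv_pos hk hkn hA hf hR hr
  have hle := le_PsiInv hA hinf hk hpos.le (hφ.Psi_deriv_le hk hkn hA hf ha hR hr)
  rw [abs_of_pos hpos, ← ENNReal.ofReal_mul hpos.le, ← div_eq_mul_inv]
  exact ENNReal.ofReal_le_one.2 (div_le_one_of_le₀ hle (hpos.le.trans hle))
end
end
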